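/- arXiv:2207.05000 — 12 statements merged into one kernel-verified Lean document; each statement's English description precedes it below -/
import Mathlib

section
/- Let G = (B,∘) be a group with identity 1 and let σ : B → Sym(B) be a map into the bijections of B such that σ_{a∘b} = σ_b ∘ σ_a for all a,b ∈ B and a ∘ σ_a(b) = b ∘ σ_b(a) for all a,b ∈ B (i.e., σ is an abelian affine structure in the sense of Rump). Then σ is a groupal affine structure on G: it satisfies σ_a(b ∘ σ_b(c)) = σ_a(b) ∘ σ_{σ_a(b)}(σ_a(c)) for all a,b,c ∈ B, and σ_a(1) = 1 for every a ∈ B. -/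
/-- An abelian affine structure (in the sense of Rump) on a group G = (B,∘)
is a groupal affine structure. -/
theorem abelian_affine_is_groupal {B : Type*} [Group B] (σ : B → B → B)
    (hbij : ∀ a : B, Function.Bijective (σ a))
    (hanti : ∀ a b : B, σ (a * b) = σ b ∘ σ a)
    (habelian : ∀ a b : B, a * σ a b = b * σ b a) :
    (∀ a b c : B, σ a (b * σ b c) = σ a b * σ (σ a b) (σ a c)) ∧
      (∀ a : B, σ a 1 = 1) := by
  -- Write `x ⊕ y = x * σ x y`; this operation is commutative.
  have sum_sum : ∀ a b c : B,
      (a * σ a b) * σ (a * σ a b) c = a * (σ a b * σ (σ a b) (σ a c)) := by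
    intro a b c
    rw [hanti, Function.comp_apply, mul_assoc]
  have right_comm : ∀ a b c : B,
      (a * σ a b) * σ (a * σ a b) c = (a * σ a c) * σ (a * σ a c) b := by
    intro a b c
    rw [sum_sum, sum_sum, habelian (σ a b)]
  refine ⟨fun a b c => mul_left_cancel (a := a) ?_, fun a => ?_⟩
  · rw [← sum_sum, right_comm, habelian a c, right_comm, habelian c b, habelian a]
  · have one_apply : σ 1 a = a := by
      apply (hbij 1).injective
      rw [← Function.comp_apply (f := σ 1), ← hanti, mul_one]
    simpa [one_apply] using habelian a 1
end

section
/- Let G = (B,∘) be a group and let φ, ω : B → (B → B) be affine structures on G such that (c1) φ_a ∘ ω_b = ω_b ∘ φ_a for all a,b ∈ B, and (c2) φ_{b ∘ (ω_a(b))⁻} = ω_{φ_a(ω_a(b)) ∘ (ω_a(b))⁻} for all a,b ∈ B, where x⁻ denotes the inverse in (B,∘). Then the map σ : B → (B → B) given by σ_a := φ_a ∘ ω_a for every a ∈ B is an affine structure on G. -/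
/-- If φ and ω are affine structures on G satisfying (c1) and (c2),
then σ_a := φ_a ∘ ω_a is an affine structure on G. -/
theorem comp_affine_structure {B : Type*} [Group B] (φ ω : B → B → B)
    (hφanti : ∀ a b : B, φ (a * b) = φ b ∘ φ a)
    (hφaff : ∀ a b c : B, φ a (b * φ b c) = φ a b * φ (φ a b) (φ a c))
    (hωanti : ∀ a b : B, ω (a * b) = ω b ∘ ω a)
    (hωaff : ∀ a b c : B, ω a (b * ω b c) = ω a b * ω (ω a b) (ω a c))
    (c1 : ∀ a b : B, φ a ∘ ω b = ω b ∘ φ a)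
    (c2 : ∀ a b : B, φ (b * (ω a b)⁻¹) = ω (φ a (ω a b) * (ω a b)⁻¹)) :
    let σ : B → B → B := fun a => φ a ∘ ω a
    ((∀ a b : B, σ (a * b) = σ b ∘ σ a) ∧
     (∀ a b c : B, σ a (b * σ b c) = σ a b * σ (σ a b) (σ a c))) := by
  have comm : ∀ a b x : B, φ a (ω b x) = ω b (φ a x) := fun a b x => congrFun (c1 a b) x
  have φmul : ∀ a b x : B, φ (a * b) x = φ b (φ a x) := fun a b x => congrFun (hφanti a b) x
  have ωmul : ∀ a b x : B, ω (a * b) x = ω b (ω a x) := fun a b x => congrFun (hωanti a b) x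
  refine ⟨fun a b => funext fun x => ?_, fun a b c => ?_⟩
  · change φ (a * b) (ω (a * b) x) = φ b (ω b (φ a (ω a x)))
    rw [φmul, ωmul, comm a b]
  · change φ a (ω a (b * φ b (ω b c)))
      = φ a (ω a b) * φ (φ a (ω a b)) (ω (φ a (ω a b)) (φ a (ω a c)))
    have key : ∀ x : B, ω (ω a b) (φ b x) = φ (ω a b) (ω (φ a (ω a b)) x) := by
      intro x
      have hb : φ b x = φ (ω a b) (φ (b * (ω a b)⁻¹) x) := by
        rw [← φmul, inv_mul_cancel_right]
      rw [hb, c2, ← comm, ← ωmul, inv_mul_cancel_right]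
    rw [comm b b, hωaff, ← comm b a, key, hφaff, comm a (φ a (ω a b))]
end

section
/- Let G = (B,∘) be a group and let φ, ω : B → (B → B) be cancellative affine structures on G such that (c1) φ_a ∘ ω_b = ω_b ∘ φ_a for all a,b ∈ B, and (c2') φ_{ω_{a⁻}(b) ∘ b⁻} = ω_{φ_a(b) ∘ b⁻} for all a,b ∈ B, where x⁻ denotes the inverse in (B,∘). Then the map σ : B → (B → B) given by σ_a := φ_a ∘ ω_a for every a ∈ B is a cancellative affine structure on G. Moreover, if ω and φ are groupal, then σ is groupal. -/
/-- If φ and ω are cancellative affine structures on G satisfying (c1) and (c2'),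
then σ_a := φ_a ∘ ω_a is a cancellative affine structure on G; moreover if ω and φ are
groupal, so is σ. -/
theorem comp_cancellative_affine_structure {B : Type*} [Group B] (φ ω : B → B → B)
    (hφbij : ∀ a : B, Function.Bijective (φ a))
    (hωbij : ∀ a : B, Function.Bijective (ω a))
    (hφanti : ∀ a b : B, φ (a * b) = φ b ∘ φ a)
    (hφaff : ∀ a b c : B, φ a (b * φ b c) = φ a b * φ (φ a b) (φ a c))
    (hωanti : ∀ a b : B, ω (a * b) = ω b ∘ ω a)
    (hωaff : ∀ a b c : B, ω a (b * ω b c) = ω a b * ω (ω a b) (ω a c))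
    (c1 : ∀ a b : B, φ a ∘ ω b = ω b ∘ φ a)
    (c2' : ∀ a b : B, φ (ω a⁻¹ b * b⁻¹) = ω (φ a b * b⁻¹)) :
    let σ : B → B → B := fun a => φ a ∘ ω a
    ((∀ a b : B, σ (a * b) = σ b ∘ σ a) ∧
     (∀ a b c : B, σ a (b * σ b c) = σ a b * σ (σ a b) (σ a c)) ∧
     (∀ a : B, Function.Bijective (σ a)) ∧
     (((∀ a : B, φ a 1 = 1) ∧ (∀ a : B, ω a 1 = 1)) → ∀ a : B, σ a 1 = 1)) := by
  have hφmul (a b x : B) : φ b (φ a x) = φ (a * b) x := (congrFun (hφanti a b) x).symm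
  have hωmul (a b x : B) : ω b (ω a x) = ω (a * b) x := (congrFun (hωanti a b) x).symm
  have hcomm (a b x : B) : φ a (ω b x) = ω b (φ a x) := congrFun (c1 a b) x
  have hωone (x : B) : ω 1 x = x := (hωbij 1).injective (by rw [hωmul, mul_one])
  have hφω (a b x : B) : φ (b * (ω a b)⁻¹) x = ω (φ a (ω a b) * (ω a b)⁻¹) x := by
    have h := congrFun (c2' a (ω a b)) x
    rwa [hωmul, mul_inv_cancel, hωone] at h
  refine ⟨fun a b => ?_, fun a b c => ?_, fun a => (hφbij a).comp (hωbij a), ?_⟩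
  · funext x
    simp only [Function.comp_apply]
    rw [← hφmul, ← hωmul, hcomm a b]
  · simp only [Function.comp_apply]
    have key : ω (ω a b) (ω a (φ b c)) =
        φ (ω a b) (ω (φ a (ω a b)) (ω a c)) := by
      calc ω (ω a b) (ω a (φ b c))
          = φ b (ω (ω a b) (ω a c)) := by rw [hcomm, hcomm]
        _ = φ (ω a b) (φ (b * (ω a b)⁻¹) (ω (ω a b) (ω a c))) := by
          rw [hφmul, inv_mul_cancel_right]
        _ = φ (ω a b) (ω (φ a (ω a b)) (ω a c)) := by
          rw [hcomm (b * (ω a b)⁻¹), hφω, hωmul _ (ω a b), inv_mul_cancel_right]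
    rw [hcomm b b, hωaff, key, hφaff, hcomm a (φ a (ω a b))]
  · rintro ⟨hφ, hω⟩ a
    simp only [Function.comp_apply, hω, hφ]
end

section
/- Let G = (B,∘) be a group and σ an affine structure on G. Define a binary operation + on B by a + b := a ∘ σ_a(b) for all a,b ∈ B. Then (B,+) is a semigroup (+ is associative) and the identity a∘(b + c) = a∘b + a∘(a⁻ + c) holds for all a,b,c ∈ B, where a⁻ is the inverse of a in (B,∘); that is, (B, +, ∘) is a left semi-brace. -/
/-- The addition a + b := a ∘ σ_a(b) associated to an affine structure σ on a
group G = (B,∘) makes B into a left semi-brace. -/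
theorem affine_structure_gives_semibrace {B : Type*} [Group B] (σ : B → B → B)
    (hanti : ∀ a b : B, σ (a * b) = σ b ∘ σ a)
    (haff : ∀ a b c : B, σ a (b * σ b c) = σ a b * σ (σ a b) (σ a c)) :
    let add : B → B → B := fun a b => a * σ a b
    ((∀ a b c : B, add (add a b) c = add a (add b c)) ∧
     (∀ a b c : B, a * add b c = add (a * b) (a * add a⁻¹ c))) := by
  have hcomp : ∀ a b c : B, σ (a * b) c = σ b (σ a c) := fun a b => congrFun (hanti a b)
  refine ⟨fun a b c => ?_, fun a b c => ?_⟩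
  · change a * σ a b * σ (a * σ a b) c = a * σ a (b * σ b c)
    rw [haff, hcomp, mul_assoc]
  · change a * (b * σ b c) = a * b * σ (a * b) (a * (a⁻¹ * σ a⁻¹ c))
    rw [mul_inv_cancel_left, ← hcomp, inv_mul_cancel_left, mul_assoc]
end

section
/- Let G = (B,∘) be a group with identity 1 and σ a groupal affine structure on G. Define a + b := a ∘ σ_a(b) for all a,b ∈ B. Then (B,+) is a group with identity 1, in which the inverse of a is −a = σ_{a⁻}(a⁻), where a⁻ is the inverse of a in (B,∘); hence (B, +, ∘) is a skew brace (the identity a∘(b + c) = a∘b + a∘(a⁻ + c) holds and (B,+) is a group). -/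
/-- For a groupal affine structure σ on a group G = (B,∘) with identity 1,
the addition a + b := a ∘ σ_a(b) makes (B,+) into a group with identity 1 and inverse
−a = σ_{a⁻}(a⁻); hence (B,+,∘) is a skew brace. -/
theorem groupal_affine_gives_skew_brace {B : Type*} [Group B] (σ : B → B → B)
    (hbij : ∀ a : B, Function.Bijective (σ a))
    (hanti : ∀ a b : B, σ (a * b) = σ b ∘ σ a)
    (haff : ∀ a b c : B, σ a (b * σ b c) = σ a b * σ (σ a b) (σ a c))
    (hgroupal : ∀ a : B, σ a 1 = 1) :
    let add : B → B → B := fun a b => a * σ a b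
    ((∀ a b c : B, add (add a b) c = add a (add b c)) ∧
     (∀ a : B, add a 1 = a) ∧
     (∀ a : B, add 1 a = a) ∧
     (∀ a : B, add a (σ a⁻¹ a⁻¹) = 1) ∧
     (∀ a : B, add (σ a⁻¹ a⁻¹) a = 1) ∧
     (∀ a b c : B, a * add b c = add (a * b) (a * add a⁻¹ c))) := by
  intro add
  have comp (a b c : B) : σ (a * b) c = σ b (σ a c) := congrFun (hanti a b) c
  have one (a : B) : σ 1 a = a := (hbij 1).injective (by rw [← comp, one_mul])
  have inv_left (a b : B) : σ a (σ a⁻¹ b) = b := by rw [← comp, inv_mul_cancel, one]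
  have add_assoc' (a b c : B) : add (add a b) c = add a (add b c) := by
    simp only [add, comp, haff, mul_assoc]
  have add_one (a : B) : add a 1 = a := by simp only [add, hgroupal, mul_one]
  have one_add (a : B) : add 1 a = a := by simp only [add, one, one_mul]
  have add_neg (a : B) : add a (σ a⁻¹ a⁻¹) = 1 := by
    simp only [add, inv_left, mul_inv_cancel]
  refine ⟨add_assoc', add_one, one_add, add_neg, fun a => ?_, fun a b c => ?_⟩
  · obtain ⟨n, hn⟩ : ∃ n, add (σ a⁻¹ a⁻¹) n = 1 := ⟨_, add_neg _⟩
    have h : a = n := by rw [← add_one a, ← hn, ← add_assoc', add_neg, one_add]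
    exact h ▸ hn
  · simp only [add, comp, mul_inv_cancel_left, inv_left, mul_assoc]
end

section
/- Let (B, +, ∘) be a left semi-brace. Then the map σ : B → (B → B) defined by σ_a(b) := λ_{a⁻}(b) = a⁻ ∘ (a + b) is an affine structure on the group (B,∘): σ_{a∘b} = σ_b ∘ σ_a for all a,b ∈ B, and σ_a(b ∘ σ_b(c)) = σ_a(b) ∘ σ_{σ_a(b)}(σ_a(c)) for all a,b,c ∈ B. Moreover a + b = a ∘ σ_a(b) for all a,b ∈ B. -/
/-- For a left semi-brace (B,+,∘), the map σ_a(b) := a⁻ ∘ (a + b) is an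
affine structure on the group (B,∘), and a + b = a ∘ σ_a(b). -/
theorem semibrace_gives_affine_structure {B : Type*} [Group B] (add : B → B → B)
    (hassoc : ∀ a b c : B, add (add a b) c = add a (add b c))
    (hsb : ∀ a b c : B, a * add b c = add (a * b) (a * add a⁻¹ c)) :
    let σ : B → B → B := fun a b => a⁻¹ * add a b
    ((∀ a b : B, σ (a * b) = σ b ∘ σ a) ∧
     (∀ a b c : B, σ a (b * σ b c) = σ a b * σ (σ a b) (σ a c)) ∧
     (∀ a b : B, add a b = a * σ a b)) := by
  intro σ
  have add_one_add (b c : B) : add b (add 1 c) = add b c := by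
    simpa using (hsb 1 b c).symm
  refine ⟨fun a b => funext fun c => ?_, fun a b c => ?_, fun a b => ?_⟩
  · have h_one : add a⁻¹ (a⁻¹ * add a c) = a⁻¹ * add 1 c := by
      simpa using (hsb a⁻¹ 1 c).symm
    have h : a * add b (a⁻¹ * add a c) = add (a * b) c := by
      rw [hsb, h_one, mul_inv_cancel_left, add_one_add]
    simp only [σ, Function.comp_apply]
    rw [← h, mul_inv_rev, mul_assoc, inv_mul_cancel_left]
  · have h := hsb a⁻¹ (add a b) c
    rw [inv_inv, hassoc] at h
    simp only [σ, mul_inv_cancel_left]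
    exact h
  · simp only [σ, mul_inv_cancel_left]
end

section
/- Let (B, +, ∘) be a left semi-brace. Then the map a ↦ λ_a is a homomorphism from the group (B,∘) to the monoid of self-maps of B under composition: λ_{a∘b} = λ_a ∘ λ_b for all a,b ∈ B, and λ_0 ∘ λ_0 = λ_0 where 0 is the identity of (B,∘). -/
/-- In a left semi-brace (B,+,∘), the map a ↦ λ_a (λ_a(b) := a∘(a⁻ + b))
is a homomorphism from (B,∘) to the monoid of self-maps of B: λ_{a∘b} = λ_a ∘ λ_b and
λ_0 ∘ λ_0 = λ_0, where 0 is the identity of (B,∘). -/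
theorem semibrace_lambda_homomorphism {B : Type*} [Group B] (add : B → B → B)
    (hassoc : ∀ a b c : B, add (add a b) c = add a (add b c))
    (hsb : ∀ a b c : B, a * add b c = add (a * b) (a * add a⁻¹ c)) :
    let lam : B → B → B := fun a b => a * add a⁻¹ b
    ((∀ a b : B, lam (a * b) = lam a ∘ lam b) ∧ (lam 1 ∘ lam 1 = lam 1)) := by
  intro lam
  have hmul : ∀ a b : B, lam (a * b) = lam a ∘ lam b := by
    intro a b
    funext c
    have h : b * add (a * b)⁻¹ c = add a⁻¹ (b * add b⁻¹ c) := by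
      rw [hsb, mul_inv_rev, mul_inv_cancel_left]
    change a * b * add (a * b)⁻¹ c = a * add a⁻¹ (b * add b⁻¹ c)
    rw [mul_assoc, h]
  refine ⟨hmul, ?_⟩
  rw [← hmul, one_mul]
end

section
/- Let (B, +, ∘) be a left cancellative left semi-brace, i.e., a left semi-brace in which the semigroup (B,+) is left cancellative. Then for every a ∈ B, the map λ_a is a bijection of B. -/
/-- In a left cancellative left semi-brace (B,+,∘), each λ_a is a bijection
of B. -/
theorem cancellative_semibrace_lambda_bijective {B : Type*} [Group B] (add : B → B → B)
    (hassoc : ∀ a b c : B, add (add a b) c = add a (add b c))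
    (hsb : ∀ a b c : B, a * add b c = add (a * b) (a * add a⁻¹ c))
    (hcanc : ∀ a b c : B, add a b = add a c → b = c) :
    ∀ a : B, Function.Bijective (fun b => a * add a⁻¹ b) := by
  have one_add (c : B) : add 1 c = c := by
    have h := hsb 1 1 c
    simp only [one_mul, inv_one] at h
    exact (hcanc _ _ _ h).symm
  intro a
  refine ⟨fun b c h => hcanc _ _ _ (mul_left_cancel h), fun b => ⟨a⁻¹ * add a⁻¹⁻¹ b, ?_⟩⟩
  have h := hsb a⁻¹ 1 b
  rw [mul_one] at h
  change a * add a⁻¹ (a⁻¹ * add a⁻¹⁻¹ b) = b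
  rw [← h, mul_inv_cancel_left, one_add]
end

section
/- Let (B, +, ∘) be a left cancellative left semi-brace. Then the map b ↦ ρ_b, where ρ_b(a) := (a⁻ + b)⁻ ∘ b, is a semigroup anti-homomorphism from (B,∘) to the monoid of self-maps of B: ρ_{b∘c} = ρ_c ∘ ρ_b for all b,c ∈ B. -/
/-- In a left cancellative left semi-brace (B,+,∘), the map b ↦ ρ_b, where
ρ_b(a) := (a⁻ + b)⁻ ∘ b, is a semigroup anti-homomorphism from (B,∘) to the self-maps
of B: ρ_{b∘c} = ρ_c ∘ ρ_b. -/
theorem cancellative_semibrace_rho_antihomomorphism {B : Type*} [Group B] (add : B → B → B)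
    (hassoc : ∀ a b c : B, add (add a b) c = add a (add b c))
    (hsb : ∀ a b c : B, a * add b c = add (a * b) (a * add a⁻¹ c))
    (hcanc : ∀ a b c : B, add a b = add a c → b = c) :
    let ρ : B → B → B := fun b a => (add a⁻¹ b)⁻¹ * b
    ∀ b c : B, ρ (b * c) = ρ c ∘ ρ b := by
  intro ρ b c
  have one_add : ∀ x : B, add 1 x = x := fun x => by
    have h := hsb 1 1 x
    simp only [one_mul, inv_one] at h
    exact (hcanc _ _ _ h).symm
  funext a
  have key : b * add (b⁻¹ * add a⁻¹ b) c = add a⁻¹ (b * c) := by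
    rw [hsb, mul_inv_cancel_left, hassoc]
    congr 1
    have h := hsb b 1 c
    rw [one_add, mul_one] at h
    exact h.symm
  simp only [ρ, Function.comp_apply, mul_inv_rev, inv_inv]
  rw [← key]
  group
end

section
/- Let G = (B,∘) be a group with identity 1 and suppose given maps (u,a) ↦ ᵘa and (u,a) ↦ uᵃ from B × B to B satisfying, for all a,b,u,v ∈ B: (Z1) ᵘ(a∘b) = ᵘa ∘ (uᵃ)′b where (uᵃ)′b denotes ^{uᵃ}b, and ^{u∘v}a = ᵘ(ᵛa); (Z2) (u∘v)ᵃ = u^{ᵛa} ∘ vᵃ and u^{a∘b} = (uᵃ)ᵇ; and the compatibility u ∘ a = ᵘa ∘ uᵃ. Then the map σ : B → (B → B) defined by σ_u(a) := ^{u⁻}a, where u⁻ is the inverse of u in (B,∘), is an affine structure on G. -/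
/-- A Zappa–Szép product structure of a group G = (B,∘) with itself
satisfying u ∘ a = ᵘa ∘ uᵃ determines an affine structure σ_u(a) := ^{u⁻}a on G. -/
theorem zappa_szep_gives_affine_structure {B : Type*} [Group B]
    (L : B → B → B) (R : B → B → B)
    (hZ1a : ∀ u a b : B, L u (a * b) = L u a * L (R u a) b)
    (hZ1b : ∀ u v a : B, L (u * v) a = L u (L v a))
    (hZ2a : ∀ u v a : B, R (u * v) a = R u (L v a) * R v a)
    (hZ2b : ∀ u a b : B, R u (a * b) = R (R u a) b)
    (hcompat : ∀ u a : B, u * a = L u a * R u a) :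
    let σ : B → B → B := fun u a => L u⁻¹ a
    ((∀ u v : B, σ (u * v) = σ v ∘ σ u) ∧
     (∀ u a b : B, σ u (a * σ a b) = σ u a * σ (σ u a) (σ u b))) := by
  intro σ
  refine ⟨fun u v => funext fun a => ?_, fun u a b => ?_⟩
  · simp only [σ, Function.comp_apply, mul_inv_rev, hZ1b]
  · have hR : R u⁻¹ a * a⁻¹ = (L u⁻¹ a)⁻¹ * u⁻¹ := by
      rw [mul_inv_eq_iff_eq_mul, mul_assoc, hcompat u⁻¹ a, inv_mul_cancel_left]
    simp only [σ]
    rw [hZ1a, ← hZ1b, ← hZ1b, hR]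
end

section
/- Let G = (B,∘) be a group and σ a cancellative affine structure on G. Define ᵘa := σ_{u⁻}(a) and uᵃ := (ᵘa)⁻ ∘ u ∘ a for all a,u ∈ B. Then for all a,b,u,v ∈ B the Zappa–Szép identities hold: ᵘ(a∘b) = ᵘa ∘ ^{uᵃ}b, ^{u∘v}a = ᵘ(ᵛa), (u∘v)ᵃ = u^{ᵛa} ∘ vᵃ, and u^{a∘b} = (uᵃ)ᵇ; moreover u ∘ a = ᵘa ∘ uᵃ. -/
/-- A cancellative affine structure σ on a group G = (B,∘) determines a
Zappa–Szép product of G with itself via ᵘa := σ_{u⁻}(a) and uᵃ := (ᵘa)⁻ ∘ u ∘ a. -/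
theorem cancellative_affine_gives_zappa_szep {B : Type*} [Group B] (σ : B → B → B)
    (hbij : ∀ a : B, Function.Bijective (σ a))
    (hanti : ∀ a b : B, σ (a * b) = σ b ∘ σ a)
    (haff : ∀ a b c : B, σ a (b * σ b c) = σ a b * σ (σ a b) (σ a c)) :
    let L : B → B → B := fun u a => σ u⁻¹ a
    let R : B → B → B := fun u a => (L u a)⁻¹ * u * a
    ((∀ u a b : B, L u (a * b) = L u a * L (R u a) b) ∧
     (∀ u v a : B, L (u * v) a = L u (L v a)) ∧
     (∀ u v a : B, R (u * v) a = R u (L v a) * R v a) ∧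
     (∀ u a b : B, R u (a * b) = R (R u a) b) ∧
     (∀ u a : B, u * a = L u a * R u a)) := by
  intro L R
  have hone : ∀ x : B, σ 1 x = x := fun x => (hbij 1).injective (by
    simpa using (congrFun (hanti 1 1) x).symm)
  have hmul : ∀ a b x : B, σ (a * b) x = σ b (σ a x) := fun a b x => congrFun (hanti a b) x
  have hinv : ∀ a x : B, σ a (σ a⁻¹ x) = x := fun a x => by
    rw [← hmul, inv_mul_cancel, hone]
  have hLmul : ∀ u v a : B, L (u * v) a = L u (L v a) := fun u v a => by
    simp only [L, mul_inv_rev, hmul]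
  have hL : ∀ u a b : B, L u (a * b) = L u a * L (R u a) b := fun u a b => by
    have h := haff u⁻¹ a (σ a⁻¹ b)
    rw [hinv] at h
    simp only [L, R, mul_inv_rev, inv_inv, hmul]
    exact h
  refine ⟨hL, hLmul, fun u v a => ?_, fun u a b => ?_, fun u a => ?_⟩
  · change (L (u * v) a)⁻¹ * (u * v) * a =
      (L u (L v a))⁻¹ * u * L v a * ((L v a)⁻¹ * v * a)
    rw [hLmul]
    group
  · change (L u (a * b))⁻¹ * u * (a * b) =
      (L (R u a) b)⁻¹ * ((L u a)⁻¹ * u * a) * b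
    rw [hL]
    group
  · change u * a = L u a * ((L u a)⁻¹ * u * a)
    group
end

section
/- Let (B, +, ∘) be a skew brace (so (B,+) and (B,∘) are groups and a∘(b + c) = a∘b + a∘(a⁻ + c) for all a,b,c ∈ B), and let σ_a(b) := a⁻ ∘ (a + b) be its associated affine structure. Then B is a bi-skew brace, i.e., a + b∘c = (a + b) ∘ a⁻ ∘ (a + c) for all a,b,c ∈ B, if and only if σ_{a ∘ σ_a(b)} = σ_{b ∘ a} as maps, for all a,b ∈ B (equivalently, σ_{a+b} = σ_{b∘a} for all a,b ∈ B). -/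
/-- A skew brace (B,+,∘), with associated affine structure
σ_a(b) := a⁻ ∘ (a + b), is a bi-skew brace iff σ_{a ∘ σ_a(b)} = σ_{b ∘ a} for all a,b. -/
theorem skew_brace_biskew_iff_sigma_condition {B : Type*} [Group B]
    (add : B → B → B) (zero : B) (neg : B → B)
    (haddassoc : ∀ a b c : B, add (add a b) c = add a (add b c))
    (hzero_add : ∀ a : B, add zero a = a)
    (hadd_zero : ∀ a : B, add a zero = a)
    (hneg_add : ∀ a : B, add (neg a) a = zero)
    (hadd_neg : ∀ a : B, add a (neg a) = zero)
    (hsb : ∀ a b c : B, a * add b c = add (a * b) (a * add a⁻¹ c)) :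
    let σ : B → B → B := fun a b => a⁻¹ * add a b
    ((∀ a b c : B, add a (b * c) = add a b * a⁻¹ * add a c) ↔
      (∀ a b : B, σ (a * σ a b) = σ (b * a))) := by
  intro σ
  have hσ : ∀ a b, add a b = a * σ a b := fun a b => by simp [σ]
  -- `σ` is an antihomomorphism from the multiplicative group to the self-maps of `B`
  have hanti : ∀ a b c, σ (b * a) c = σ a (σ b c) := fun a b c => by
    have h := hsb b⁻¹ (b * a) c
    simp only [inv_inv, inv_mul_cancel_left] at h
    simp only [σ, mul_inv_rev, mul_assoc, h]
  -- associativity of `add` in terms of `σ`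
  have hassoc : ∀ a b c, σ a (b * σ b c) = σ a b * σ (a * σ a b) c := fun a b c => by
    have h := haddassoc a b c
    simp only [hσ, mul_assoc] at h
    exact (mul_left_cancel h).symm
  constructor
  · intro h a b
    funext c
    have hmul : σ a (b * σ b c) = σ a b * σ a (σ b c) := by
      simp only [σ, h, mul_assoc]
    rw [hanti a b]
    exact mul_left_cancel ((hassoc a b c).symm.trans hmul)
  · intro h a b d
    have hd : σ b (add (neg b) (b * d)) = d := by
      simp only [σ, ← haddassoc, hadd_neg, hzero_add, inv_mul_cancel_left]
    have hmul := hassoc a b (add (neg b) (b * d))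
    rw [h, hanti a b, hd] at hmul
    simp only [hσ a, hmul, mul_assoc, inv_mul_cancel_left]
end
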